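/- Let U ∈ 𝔖_F(𝕊_1^+) with F ∈ L^∞(𝕊_1^+). Then for every r ∈ (0,1), I(U,r) = D(U,r) − r^{−2} ∫_{𝕊_r^+} |t| U F Ḡ_a y^a dX dt. -/

import Mathlib

/- Formalization of results from "The structure of the singular set in the thin obstacle
problem for degenerate parabolic equations" by Banerjee, Danielli, Garofalo, Petrosyan.

Points of ℝ^{n+1} are written X = (x,y) with x : Fin n → ℝ and y : ℝ; functions of
space-time are `U : (Fin n → ℝ) → ℝ → ℝ → ℝ`, with `U x y t`. -/

noncomputable section

open MeasureTheory Filter Topology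

/-- Functions on ℝⁿ × ℝ × ℝ, written `U x y t` for `X = (x,y)` and time `t`. -/
abbrev Fn (n : ℕ) := (Fin n → ℝ) → ℝ → ℝ → ℝ

/-- Space-time points `(x, y, t)`. -/
abbrev Pt (n : ℕ) := (Fin n → ℝ) × ℝ × ℝ

/-- Partial derivative in the direction of the i-th thin coordinate. -/
def pdx {n : ℕ} (i : Fin n) (U : Fn n) (x : Fin n → ℝ) (y t : ℝ) : ℝ :=
  fderiv ℝ (fun x' => U x' y t) x (Pi.single i 1)

/-- Partial derivative in the extension variable y. -/
def pdy {n : ℕ} (U : Fn n) (x : Fin n → ℝ) (y t : ℝ) : ℝ :=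
  deriv (fun y' => U x y' t) y

/-- Time derivative. -/
def pdt {n : ℕ} (U : Fn n) (x : Fin n → ℝ) (y t : ℝ) : ℝ :=
  deriv (fun t' => U x y t') t

/-- Squared norm |∇U|² of the full spatial gradient. -/
def gradSq {n : ℕ} (U : Fn n) (x : Fin n → ℝ) (y t : ℝ) : ℝ :=
  (∑ i, (pdx i U x y t) ^ 2) + (pdy U x y t) ^ 2

/-- |∇V − ∇W|². -/
def gradDiffSq {n : ℕ} (V W : Fn n) (x : Fin n → ℝ) (y t : ℝ) : ℝ :=
  (∑ i, (pdx i V x y t - pdx i W x y t) ^ 2) + (pdy V x y t - pdy W x y t) ^ 2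

/-- The generator Z f = ⟨X, ∇f⟩ + 2 t ∂ₜ f of the parabolic dilations. -/
def Zop {n : ℕ} (U : Fn n) (x : Fin n → ℝ) (y t : ℝ) : ℝ :=
  (∑ i, x i * pdx i U x y t) + y * pdy U x y t + 2 * t * pdt U x y t

/-- Laplacian in the x variables only. -/
def lapx {n : ℕ} (U : Fn n) (x : Fin n → ℝ) (y t : ℝ) : ℝ :=
  ∑ i, pdx i (fun x' y' t' => pdx i U x' y' t') x y t

/-- Second derivative in y. -/
def pdyy {n : ℕ} (U : Fn n) (x : Fin n → ℝ) (y t : ℝ) : ℝ :=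
  pdy (fun x' y' t' => pdy U x' y' t') x y t

/-- Full spatial Laplacian in the variables X = (x,y). -/
def lapFull {n : ℕ} (U : Fn n) (x : Fin n → ℝ) (y t : ℝ) : ℝ :=
  lapx U x y t + pdyy U x y t

/-- |X|² for X = (x,y). -/
def nsq {n : ℕ} (x : Fin n → ℝ) (y : ℝ) : ℝ := (∑ i, (x i) ^ 2) + y ^ 2

/-- The backward Neumann fundamental solution Ḡ_a(X,t), for t < 0. -/
def Gbar (n : ℕ) (a : ℝ) (x : Fin n → ℝ) (y t : ℝ) : ℝ :=
  (4 * Real.pi) ^ (-(n : ℝ) / 2) / ((2:ℝ) ^ a * Real.Gamma ((a + 1) / 2)) *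
    |t| ^ (-((n : ℝ) + a + 1) / 2) * Real.exp (-(nsq x y) / (4 * |t|))

/-- The half-strip 𝕊_r⁺ = ℝ^{n+1}_+ × (−r², 0]. -/
def Splus (n : ℕ) (r : ℝ) : Set (Pt n) :=
  {p | 0 < p.2.1 ∧ p.2.2 ∈ Set.Ioc (-(r ^ 2)) 0}

/-- The Gaussian weight Ḡ_a(X,t) yᵃ. -/
def wgt (n : ℕ) (a : ℝ) (p : Pt n) : ℝ :=
  Gbar n a p.1 p.2.1 p.2.2 * p.2.1 ^ a

/-- The height function H(U,r). -/
def Hfn (n : ℕ) (a : ℝ) (U : Fn n) (r : ℝ) : ℝ :=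
  (1 / r ^ 2) * ∫ p in Splus n r, (U p.1 p.2.1 p.2.2) ^ 2 * wgt n a p

/-- The energy D(U,r). -/
def Dfn (n : ℕ) (a : ℝ) (U : Fn n) (r : ℝ) : ℝ :=
  (1 / r ^ 2) * ∫ p in Splus n r, |p.2.2| * gradSq U p.1 p.2.1 p.2.2 * wgt n a p

/-- The total energy I(U,r). -/
def Ifn (n : ℕ) (a : ℝ) (U : Fn n) (r : ℝ) : ℝ :=
  (1 / (2 * r ^ 2)) * ∫ p in Splus n r, U p.1 p.2.1 p.2.2 * Zop U p.1 p.2.1 p.2.2 * wgt n a p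

/-- The set of thin points in S₁ where both U and its weighted normal derivative
∂_yᵃ U vanish.  The extended free boundary Γ_*(U) is its boundary in S₁. -/
def ZeroSet (n : ℕ) (a : ℝ) (U : Fn n) : Set ((Fin n → ℝ) × ℝ) :=
  {q | q.2 ∈ Set.Ioc (-1 : ℝ) 0 ∧ U q.1 0 q.2 = 0 ∧
    Tendsto (fun y => y ^ a * pdy U q.1 y q.2) (𝓝[>] (0 : ℝ)) (𝓝 0)}

/-- The Signorini class 𝔖_F(𝕊₁⁺). -/
structure SignoriniMem (n : ℕ) (a : ℝ) (F U : Fn n) : Prop where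
  /-- continuity up to the thin space -/
  cont : ContinuousOn (fun p : Pt n => U p.1 p.2.1 p.2.2)
    {p : Pt n | 0 ≤ p.2.1 ∧ p.2.2 ∈ Set.Ioc (-1 : ℝ) 0}
  /-- bounded support in the space variables -/
  bddSupp : ∃ R > (0:ℝ), ∀ x y t, R ^ 2 ≤ nsq x y → U x y t = 0
  /-- smoothness in {y > 0} -/
  smooth : ∀ x y t, 0 < y → t ∈ Set.Ioc (-1 : ℝ) 0 →
    ContDiffAt ℝ (⊤ : ℕ∞) (fun p : Pt n => U p.1 p.2.1 p.2.2) (x, y, t)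
  /-- the equation yᵃ ∂ₜU = div(yᵃ ∇U) + yᵃ F holds classically in {y > 0} -/
  pde : ∀ x y t, 0 < y → t ∈ Set.Ioc (-1 : ℝ) 0 →
    pdt U x y t = lapFull U x y t + (a / y) * pdy U x y t + F x y t
  /-- ∇ₓU extends parabolically Hölder continuously up to {y = 0} -/
  holderX : ∃ α > (0:ℝ), ∃ C : ℝ, ∀ i : Fin n, ∀ x y t x' y' t',
    0 < y → 0 < y' → t ∈ Set.Ioc (-1 : ℝ) 0 → t' ∈ Set.Ioc (-1 : ℝ) 0 →
    |pdx i U x y t - pdx i U x' y' t'| ≤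
      C * ((∑ j, (x j - x' j) ^ 2) + (y - y') ^ 2 + |t - t'|) ^ (α / 2)
  /-- yᵃ ∂_y U extends parabolically Hölder continuously up to {y = 0} -/
  holderY : ∃ α > (0:ℝ), ∃ C : ℝ, ∀ x y t x' y' t',
    0 < y → 0 < y' → t ∈ Set.Ioc (-1 : ℝ) 0 → t' ∈ Set.Ioc (-1 : ℝ) 0 →
    |y ^ a * pdy U x y t - y' ^ a * pdy U x' y' t'| ≤
      C * ((∑ j, (x j - x' j) ^ 2) + (y - y') ^ 2 + |t - t'|) ^ (α / 2)
  /-- ∂ₜU ∈ L^∞(𝕊₁⁺) -/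
  bddTime : ∃ M : ℝ, ∀ x y t, 0 < y → t ∈ Set.Ioc (-1 : ℝ) 0 → |pdt U x y t| ≤ M
  /-- yᵃ |∇ ∂ₓᵢ U|² integrable on 𝕊₁⁺ -/
  intXX : ∀ i : Fin n, IntegrableOn
    (fun p : Pt n => p.2.1 ^ a * gradSq (fun x y t => pdx i U x y t) p.1 p.2.1 p.2.2)
    (Splus n 1)
  /-- y^{−a} (∂_y(yᵃ ∂_y U))² integrable on 𝕊₁⁺ -/
  intYY : IntegrableOn
    (fun p : Pt n => p.2.1 ^ (-a) *
      (pdy (fun x y t => y ^ a * pdy U x y t) p.1 p.2.1 p.2.2) ^ 2) (Splus n 1)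
  /-- U ≥ 0 on the thin space -/
  nonneg : ∀ x, ∀ t ∈ Set.Ioc (-1 : ℝ) 0, 0 ≤ U x 0 t
  /-- the Signorini complementarity conditions on the thin space -/
  signorini : ∀ x, ∀ t ∈ Set.Ioc (-1 : ℝ) 0, ∃ L ≤ (0:ℝ),
    Tendsto (fun y => y ^ a * pdy U x y t) (𝓝[>] (0 : ℝ)) (𝓝 L) ∧ U x 0 t * L = 0
  /-- (0,0) belongs to the extended free boundary Γ_*(U) -/
  originFB : (0, 0) ∈ closure (ZeroSet n a U) ∧
    (0, 0) ∈ closure ({q : (Fin n → ℝ) × ℝ | q.2 ∈ Set.Ioc (-1 : ℝ) 0} \ ZeroSet n a U)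

/-- The growth bound |F(X,t)| ≤ C_ℓ |(X,t)|^{ℓ−2} on 𝕊₁⁺. -/
def FGrowth (n : ℕ) (F : Fn n) (l Cl : ℝ) : Prop :=
  ∀ x y t, 0 < y → t ∈ Set.Ioc (-1 : ℝ) 0 →
    |F x y t| ≤ Cl * (nsq x y + |t|) ^ ((l - 2) / 2)

/-- The growth bound |∇_X F(X,t)| ≤ C_ℓ |(X,t)|^{ℓ−3} on 𝔹_{1/2}⁺ × (−1/4, 0]. -/
def FGradGrowth (n : ℕ) (F : Fn n) (l Cl : ℝ) : Prop :=
  ∀ x y t, 0 < y → nsq x y < (1/2 : ℝ) ^ 2 → t ∈ Set.Ioc (-(1/4 : ℝ)) 0 →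
    Real.sqrt (gradSq F x y t) ≤ Cl * (nsq x y + |t|) ^ ((l - 3) / 2)

/-- The growth bound |∂ₜF(X,t)| ≤ C_ℓ |(X,t)|^{ℓ−4} on 𝔹_{1/2}⁺ × (−1/4, 0]. -/
def FTimeGrowth (n : ℕ) (F : Fn n) (l Cl : ℝ) : Prop :=
  ∀ x y t, 0 < y → nsq x y < (1/2 : ℝ) ^ 2 → t ∈ Set.Ioc (-(1/4 : ℝ)) 0 →
    |pdt F x y t| ≤ Cl * (nsq x y + |t|) ^ ((l - 4) / 2)

/-- r ↦ log max{H(U,r), r^{2ℓ−2+2σ}}. -/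
def logMaxH (n : ℕ) (a : ℝ) (U : Fn n) (l σ : ℝ) (r : ℝ) : ℝ :=
  Real.log (max (Hfn n a U r) (r ^ (2 * l - 2 + 2 * σ)))

/-- The set of radii in (0,1) where `logMaxH` is differentiable (it is locally
Lipschitz, hence this set has full measure). -/
def diffSet (n : ℕ) (a : ℝ) (U : Fn n) (l σ : ℝ) : Set ℝ :=
  {r | r ∈ Set.Ioo (0 : ℝ) 1 ∧ DifferentiableAt ℝ (logMaxH n a U l σ) r}

/-- The truncated Almgren–Poon frequency Φ_{ℓ,σ}(U,·), with constant C. -/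
def Phi (n : ℕ) (a : ℝ) (U : Fn n) (l σ C : ℝ) (r : ℝ) : ℝ :=
  (1/2) * r * Real.exp (C * r ^ (1 - σ)) * deriv (logMaxH n a U l σ) r
    + 2 * (Real.exp (C * r ^ (1 - σ)) - 1)

/-- The parabolic Almgren rescalings U_r. -/
def rescale (n : ℕ) (a : ℝ) (U : Fn n) (r : ℝ) : Fn n :=
  fun x y t => U (r • x) (r * y) (r ^ 2 * t) / Real.sqrt (Hfn n a U r)

/-- The Weiss functional 𝒲_κ(U,r). -/
def Wfn (n : ℕ) (a : ℝ) (U : Fn n) (κ r : ℝ) : ℝ :=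
  r ^ (-(2 * κ)) * (Dfn n a U r - κ / 2 * Hfn n a U r)

/-- The Monneau functional M_κ(U,p_κ,r). -/
def Mfn (n : ℕ) (a : ℝ) (U pk : Fn n) (κ r : ℝ) : ℝ :=
  r ^ (-(2 * κ + 2)) *
    ∫ p in Splus n r, (U p.1 p.2.1 p.2.2 - pk p.1 p.2.1 p.2.2) ^ 2 * wgt n a p

/-- Polynomial functions of (x,t). -/
def IsPolyFun2 (n : ℕ) (q : (Fin n → ℝ) → ℝ → ℝ) : Prop :=
  ∃ P : MvPolynomial (Fin (n + 1)) ℝ, ∀ x t, q x t = MvPolynomial.eval (Fin.snoc x t) P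

/-- Polynomial functions of (x,y,t). -/
def IsPolyFun3 (n : ℕ) (q : Fn n) : Prop :=
  ∃ P : MvPolynomial (Fin (n + 2)) ℝ, ∀ x y t,
    q x y t = MvPolynomial.eval (Fin.snoc (Fin.snoc x y) t) P

/-- The class 𝒫_κ⁺ of parabolically κ-homogeneous, even in y, a-caloric polynomials
which are nonnegative on the thin space. -/
def Pkappa (n : ℕ) (a κ : ℝ) (p : Fn n) : Prop :=
  IsPolyFun3 n p ∧
  (∀ lam > (0:ℝ), ∀ x y t, p (lam • x) (lam * y) (lam ^ 2 * t) = lam ^ κ * p x y t) ∧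
  (∀ x y t, p x (-y) t = p x y t) ∧
  (∀ x t, 0 ≤ p x 0 t) ∧
  (∀ x y t, y ≠ 0 →
    pdt p x y t - lapx p x y t - pdyy p x y t - (a / y) * pdy p x y t = 0)

/-- The coincidence set Λ(U) ⊆ S₁. -/
def Lam (n : ℕ) (U : Fn n) : Set ((Fin n → ℝ) × ℝ) :=
  {q | q.2 ∈ Set.Ioc (-1 : ℝ) 0 ∧ U q.1 0 q.2 = 0}

/-- The thin parabolic cylinder Q_r = B_r × (−r²,0]. -/
def Qthin (n : ℕ) (r : ℝ) : Set ((Fin n → ℝ) × ℝ) :=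
  {q | (∑ i, (q.1 i) ^ 2) < r ^ 2 ∧ q.2 ∈ Set.Ioc (-(r ^ 2)) 0}

/-- The modified Bessel function of the first kind I_ν(z). -/
def besselI (ν z : ℝ) : ℝ :=
  ∑' k : ℕ, (z / 2) ^ (ν + 2 * (k : ℝ)) /
    (Real.Gamma ((k : ℝ) + 1) * Real.Gamma ((k : ℝ) + ν + 1))

/-- The Bessel heat kernel p^{(a)}(y,η,t). -/
def pker (a y η t : ℝ) : ℝ :=
  (2 * t) ^ (-(a + 1) / 2) * (y * η / (2 * t)) ^ ((1 - a) / 2) *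
    besselI ((a - 1) / 2) (y * η / (2 * t)) * Real.exp (-(y ^ 2 + η ^ 2) / (4 * t))


open scoped ContDiff

/-- A function of `x`, `y`, `t` as a function on space-time. -/
def unc {n : ℕ} (V : Fn n) (p : Pt n) : ℝ := V p.1 p.2.1 p.2.2

/-- The interior `ℝ^{n+1}_+ × (−r², 0)` of the half-strip. -/
def openStrip (n : ℕ) (r : ℝ) : Set (Pt n) :=
  {p | 0 < p.2.1 ∧ p.2.2 ∈ Set.Ioo (-(r ^ 2)) 0}

section Calculus

variable {n : ℕ} {V W : Fn n} {x : Fin n → ℝ} {y t r : ℝ}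

theorem isOpen_openStrip (n : ℕ) (r : ℝ) : IsOpen (openStrip n r) :=
  (isOpen_lt (g := fun p : Pt n => p.2.1) continuous_const (by fun_prop)).inter
    (isOpen_Ioo.preimage (f := fun p : Pt n => p.2.2) (by fun_prop))

theorem DifferentiableAt.unc_hasFDerivAt_x (hV : DifferentiableAt ℝ (unc V) (x, y, t)) :
    HasFDerivAt (fun x' => V x' y t)
      ((fderiv ℝ (unc V) (x, y, t)).comp (ContinuousLinearMap.inl ℝ (Fin n → ℝ) (ℝ × ℝ))) x :=
  HasFDerivAt.comp (f := fun x' => ((x', y, t) : Pt n)) x hV.hasFDerivAt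
    (hasFDerivAt_prodMk_left x (y, t))

theorem DifferentiableAt.unc_hasDerivAt_y (hV : DifferentiableAt ℝ (unc V) (x, y, t)) :
    HasDerivAt (fun y' => V x y' t) (fderiv ℝ (unc V) (x, y, t) (0, 1, 0)) y :=
  HasFDerivAt.comp_hasDerivAt (f := fun y' => ((x, y', t) : Pt n)) y hV.hasFDerivAt
    ((hasDerivAt_const y x).prodMk ((hasDerivAt_id y).prodMk (hasDerivAt_const y t)))

theorem DifferentiableAt.unc_hasDerivAt_t (hV : DifferentiableAt ℝ (unc V) (x, y, t)) :
    HasDerivAt (fun t' => V x y t') (fderiv ℝ (unc V) (x, y, t) (0, 0, 1)) t :=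
  HasFDerivAt.comp_hasDerivAt (f := fun t' => ((x, y, t') : Pt n)) t hV.hasFDerivAt
    ((hasDerivAt_const t x).prodMk ((hasDerivAt_const t y).prodMk (hasDerivAt_id t)))

theorem pdx_eq_fderiv (i : Fin n) (hV : DifferentiableAt ℝ (unc V) (x, y, t)) :
    pdx i V x y t = fderiv ℝ (unc V) (x, y, t) (Pi.single i 1, 0, 0) := by
  rw [pdx, hV.unc_hasFDerivAt_x.fderiv]
  rfl

theorem pdy_eq_fderiv (hV : DifferentiableAt ℝ (unc V) (x, y, t)) :
    pdy V x y t = fderiv ℝ (unc V) (x, y, t) (0, 1, 0) :=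
  hV.unc_hasDerivAt_y.deriv

theorem pdt_eq_fderiv (hV : DifferentiableAt ℝ (unc V) (x, y, t)) :
    pdt V x y t = fderiv ℝ (unc V) (x, y, t) (0, 0, 1) :=
  hV.unc_hasDerivAt_t.deriv

theorem ContDiffOn.unc_differentiableAt (hV : ContDiffOn ℝ ∞ (unc V) (openStrip n r)) {p : Pt n}
    (hp : p ∈ openStrip n r) : DifferentiableAt ℝ (unc V) p :=
  (hV.contDiffAt ((isOpen_openStrip n r).mem_nhds hp)).differentiableAt (by simp)

theorem ContDiffOn.fderiv_apply_openStrip (hV : ContDiffOn ℝ ∞ (unc V) (openStrip n r))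
    (v : Pt n) : ContDiffOn ℝ ∞ (fun p => fderiv ℝ (unc V) p v) (openStrip n r) :=
  (hV.fderiv_of_isOpen (isOpen_openStrip n r) (by simp)).clm_apply contDiffOn_const

theorem ContDiffOn.pdx (hV : ContDiffOn ℝ ∞ (unc V) (openStrip n r)) (i : Fin n) :
    ContDiffOn ℝ ∞ (unc (pdx i V)) (openStrip n r) :=
  (hV.fderiv_apply_openStrip (Pi.single i 1, 0, 0)).congr fun _ hp =>
    pdx_eq_fderiv i (hV.unc_differentiableAt hp)

theorem ContDiffOn.pdy (hV : ContDiffOn ℝ ∞ (unc V) (openStrip n r)) :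
    ContDiffOn ℝ ∞ (unc (pdy V)) (openStrip n r) :=
  (hV.fderiv_apply_openStrip (0, 1, 0)).congr fun _ hp =>
    pdy_eq_fderiv (hV.unc_differentiableAt hp)

theorem ContDiffOn.pdt (hV : ContDiffOn ℝ ∞ (unc V) (openStrip n r)) :
    ContDiffOn ℝ ∞ (unc (pdt V)) (openStrip n r) :=
  (hV.fderiv_apply_openStrip (0, 0, 1)).congr fun _ hp =>
    pdt_eq_fderiv (hV.unc_differentiableAt hp)

theorem pdx_mul (i : Fin n) (hV : DifferentiableAt ℝ (unc V) (x, y, t))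
    (hW : DifferentiableAt ℝ (unc W) (x, y, t)) :
    pdx i (fun x y t => V x y t * W x y t) x y t
      = pdx i V x y t * W x y t + V x y t * pdx i W x y t := by
  have h := (hV.unc_hasFDerivAt_x.differentiableAt.hasFDerivAt.mul
    hW.unc_hasFDerivAt_x.differentiableAt.hasFDerivAt).fderiv
  simp only [pdx]
  erw [h]
  simp [mul_comm, add_comm]

theorem pdy_mul (hV : DifferentiableAt ℝ (unc V) (x, y, t))
    (hW : DifferentiableAt ℝ (unc W) (x, y, t)) :
    pdy (fun x y t => V x y t * W x y t) x y t
      = pdy V x y t * W x y t + V x y t * pdy W x y t :=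
  (hV.unc_hasDerivAt_y.differentiableAt.hasDerivAt.mul
    hW.unc_hasDerivAt_y.differentiableAt.hasDerivAt).deriv

theorem contDiffOn_wgt (a : ℝ) :
    ContDiffOn ℝ ∞ (unc fun x y t => wgt n a (x, y, t)) (openStrip n r) := by
  intro p hp
  apply ContDiffAt.contDiffWithinAt
  obtain ⟨hy, -, ht⟩ := hp
  have habs : ContDiffAt ℝ ∞ (fun q : Pt n => |q.2.2|) p := by
    have h : ContDiffAt ℝ ∞ (fun q : Pt n => -q.2.2) p := by fun_prop
    refine h.congr_of_eventuallyEq ?_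
    filter_upwards [(isOpen_lt (f := fun q : Pt n => q.2.2) (by fun_prop)
      continuous_const).mem_nhds ht] with q hq using abs_of_neg hq
  have hpos : |p.2.2| ≠ 0 := by simpa using ht.ne
  unfold unc wgt Gbar nsq
  refine ((contDiffAt_const.mul (habs.rpow_const_of_ne hpos)).mul
    (ContDiffAt.exp (ContDiffAt.div ?_ (contDiffAt_const.mul habs) ?_))).mul
    (ContDiffAt.rpow_const_of_ne ?_ hy.ne')
  · fun_prop
  · simpa using ht.ne
  · fun_prop

theorem pdx_wgt (a : ℝ) (i : Fin n) (ht : t < 0) :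
    pdx i (fun x y t => wgt n a (x, y, t)) x y t = x i / (2 * t) * wgt n a (x, y, t) := by
  have h1 : HasFDerivAt (fun x' : Fin n → ℝ => nsq x' y)
      (∑ j, (2 * x j) • ContinuousLinearMap.proj (R := ℝ) (φ := fun _ : Fin n => ℝ) j) x := by
    unfold nsq
    refine (HasFDerivAt.fun_sum fun j _ => ?_).add_const _
    have := (ContinuousLinearMap.proj (R := ℝ) (φ := fun _ : Fin n => ℝ) j).hasFDerivAt
      (x := x) |>.pow 2
    simpa using this
  have h2 := (((h1.neg.mul_const (4 * |t|)⁻¹).exp.const_mul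
    ((4 * Real.pi) ^ (-(n : ℝ) / 2) / ((2:ℝ) ^ a * Real.Gamma ((a + 1) / 2)) *
    |t| ^ (-((n : ℝ) + a + 1) / 2))).mul_const (y ^ a)).fderiv
  simp only [pdx, wgt, Gbar, div_eq_mul_inv] at h2 ⊢
  erw [h2]
  simp [abs_of_neg ht, Pi.single_apply]
  ring

theorem pdy_wgt (a : ℝ) (hy : 0 < y) (ht : t < 0) :
    pdy (fun x y t => wgt n a (x, y, t)) x y t
      = (y / (2 * t) + a / y) * wgt n a (x, y, t) := by
  have h1 : HasDerivAt (fun y' : ℝ => nsq x y') (2 * y) y := by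
    unfold nsq
    simpa using (hasDerivAt_pow 2 y).const_add (∑ i, (x i) ^ 2)
  have h2 := (((h1.fun_neg.mul_const (4 * |t|)⁻¹).exp.const_mul
    ((4 * Real.pi) ^ (-(n : ℝ) / 2) / ((2:ℝ) ^ a * Real.Gamma ((a + 1) / 2)) *
    |t| ^ (-((n : ℝ) + a + 1) / 2))).fun_mul (Real.hasDerivAt_rpow_const (p := a)
      (Or.inl hy.ne'))).deriv
  simp only [pdy, wgt, Gbar, div_eq_mul_inv] at h2 ⊢
  rw [h2, Real.rpow_sub_one hy.ne', abs_of_neg ht]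
  have := ht.ne
  field_simp
  ring

end Calculus

section Measure

variable {n : ℕ} {r : ℝ}

theorem measurePreserving_restrict_strip (n : ℕ) {J : Set ℝ} (hJ : MeasurableSet J) :
    MeasurePreserving (MeasurableEquiv.prodAssoc : ((Fin n → ℝ) × ℝ) × ℝ ≃ᵐ Pt n)
      ((volume.prod (volume.restrict (Set.Ioi 0))).prod (volume.restrict J))
      (volume.restrict {p : Pt n | 0 < p.2.1 ∧ p.2.2 ∈ J}) := by
  have hS : MeasurableSet {p : Pt n | 0 < p.2.1 ∧ p.2.2 ∈ J} :=
    (measurableSet_lt measurable_const (by fun_prop : Measurable fun p : Pt n => p.2.1)).inter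
      ((by fun_prop : Measurable fun p : Pt n => p.2.2) hJ)
  have h := (volume_preserving_prodAssoc (α₁ := Fin n → ℝ) (β₁ := ℝ)
    (γ₁ := ℝ)).restrict_preimage hS
  have h1 : (volume : Measure (((Fin n → ℝ) × ℝ) × ℝ)).restrict
      ((MeasurableEquiv.prodAssoc : ((Fin n → ℝ) × ℝ) × ℝ ≃ᵐ Pt n) ⁻¹'
        {p : Pt n | 0 < p.2.1 ∧ p.2.2 ∈ J})
      = (volume.prod (volume.restrict (Set.Ioi 0))).prod (volume.restrict J) := by
    rw [← Measure.restrict_univ (μ := (volume : Measure (Fin n → ℝ))), Measure.prod_restrict,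
      Measure.prod_restrict]
    congr 1
    ext z
    simp [MeasurableEquiv.prodAssoc]
  rwa [h1] at h

theorem volume_restrict_Splus (n : ℕ) (r : ℝ) :
    (volume.restrict (Splus n r) : Measure (Pt n)) = volume.restrict (openStrip n r) := by
  rw [Splus, openStrip, ← (measurePreserving_restrict_strip n measurableSet_Ioc).map_eq,
    ← (measurePreserving_restrict_strip n measurableSet_Ioo).map_eq, restrict_Ioo_eq_restrict_Ioc]

theorem integrableOn_openStrip_iff {f : Pt n → ℝ} :
    IntegrableOn f (openStrip n r) ↔
      Integrable (fun q : ((Fin n → ℝ) × ℝ) × ℝ => f (q.1.1, q.1.2, q.2))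
        ((volume.prod (volume.restrict (Set.Ioi 0))).prod
          (volume.restrict (Set.Ioo (-(r ^ 2)) 0))) :=
  ((measurePreserving_restrict_strip n measurableSet_Ioo).integrable_comp_emb
    (MeasurableEquiv.measurableEmbedding _)).symm

theorem setIntegral_openStrip {f : Pt n → ℝ} (hf : IntegrableOn f (openStrip n r)) :
    ∫ p in openStrip n r, f p = ∫ t in Set.Ioo (-(r ^ 2)) 0,
      ∫ z, f (z.1, z.2, t) ∂((volume : Measure (Fin n → ℝ)).prod
        (volume.restrict (Set.Ioi 0))) := by
  rw [openStrip, ← (measurePreserving_restrict_strip n measurableSet_Ioo).integral_comp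
    (MeasurableEquiv.measurableEmbedding _)]
  exact integral_prod_symm _ (integrableOn_openStrip_iff.1 hf)

theorem integrableOn_abs_rpow {e : ℝ} (he : -1 < e) :
    IntegrableOn (fun t : ℝ => |t| ^ e) (Set.Ioo (-(r ^ 2)) 0) := by
  have h := (intervalIntegral.intervalIntegrable_rpow' (a := 0) (b := r ^ 2) he).comp_sub_left 0
  rw [intervalIntegrable_iff, zero_sub, zero_sub, neg_zero, Set.uIoc_comm,
    Set.uIoc_of_le (by nlinarith [sq_nonneg r])] at h
  refine (h.mono_set Set.Ioo_subset_Ioc_self).congr_fun (fun t ht => ?_) measurableSet_Ioo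
  simp [abs_of_neg ht.2]

theorem Gbar_eq_mul_prod (a : ℝ) (x : Fin n → ℝ) (y t : ℝ) :
    Gbar n a x y t = (4 * Real.pi) ^ (-(n : ℝ) / 2) / ((2:ℝ) ^ a * Real.Gamma ((a + 1) / 2)) *
      |t| ^ (-((n : ℝ) + a + 1) / 2) * ((∏ i, Real.exp (-(4 * |t|)⁻¹ * x i ^ 2)) *
        Real.exp (-(4 * |t|)⁻¹ * y ^ (2 : ℝ))) := by
  rw [Gbar, ← Real.exp_sum, ← Real.exp_add, ← Finset.mul_sum, nsq, Real.rpow_two]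
  congr 2
  ring

theorem Gbar_nonneg {a : ℝ} (ha : -1 < a) (x : Fin n → ℝ) (y t : ℝ) : 0 ≤ Gbar n a x y t := by
  have : 0 < Real.Gamma ((a + 1) / 2) := Real.Gamma_pos_of_pos (by linarith)
  unfold Gbar
  positivity

theorem integrable_Gbar_mul_rpow_slice (a : ℝ) {b t : ℝ} (hb : -1 < b) (ht : t < 0) :
    Integrable (fun z : (Fin n → ℝ) × ℝ => Gbar n a z.1 z.2 t * z.2 ^ b)
      (volume.prod (volume.restrict (Set.Ioi 0))) := by
  have hc : 0 < (4 * |t|)⁻¹ := by have := abs_pos.2 ht.ne; positivity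
  have hx : Integrable fun x : Fin n → ℝ => ∏ i, Real.exp (-(4 * |t|)⁻¹ * x i ^ 2) :=
    Integrable.fintype_prod (f := fun _ s => Real.exp (-(4 * |t|)⁻¹ * s ^ 2))
      fun _ => integrable_exp_neg_mul_sq hc
  refine ((hx.mul_prod (integrableOn_rpow_mul_exp_neg_mul_rpow hb two_pos hc)).const_mul
    ((4 * Real.pi) ^ (-(n : ℝ) / 2) / ((2:ℝ) ^ a * Real.Gamma ((a + 1) / 2)) *
      |t| ^ (-((n : ℝ) + a + 1) / 2))).congr (.of_forall fun z => ?_)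
  simp only [Gbar_eq_mul_prod]
  ring

theorem exists_integral_Gbar_mul_rpow_slice (n : ℕ) (a : ℝ) {b : ℝ} (hb : -1 < b) :
    ∃ K : ℝ, ∀ t < 0, ∫ z : (Fin n → ℝ) × ℝ, Gbar n a z.1 z.2 t * z.2 ^ b
      ∂(volume.prod (volume.restrict (Set.Ioi 0))) = K * |t| ^ ((b - a) / 2) := by
  refine ⟨(4 * Real.pi) ^ (-(n : ℝ) / 2) / ((2:ℝ) ^ a * Real.Gamma ((a + 1) / 2)) *
    (√(Real.pi * 4) ^ n * (4 ^ ((b + 1) / 2) * (1 / 2) * Real.Gamma ((b + 1) / 2))),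
    fun t ht => ?_⟩
  have ht' : 0 < |t| := abs_pos.2 ht.ne
  have hc : 0 < (4 * |t|)⁻¹ := by positivity
  have hsqrt : √(Real.pi / (4 * |t|)⁻¹) ^ n = √(Real.pi * 4) ^ n * |t| ^ (1 / 2 * n : ℝ) := by
    rw [div_inv_eq_mul, ← mul_assoc, Real.sqrt_mul (by positivity), mul_pow,
      Real.sqrt_eq_rpow |t|, ← Real.rpow_mul_natCast (by positivity)]
  have hinv : (4 * |t|)⁻¹ ^ (-(b + 1) / 2) = 4 ^ ((b + 1) / 2) * |t| ^ ((b + 1) / 2) := by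
    rw [neg_div, Real.rpow_neg (by positivity), Real.inv_rpow (by positivity), inv_inv,
      Real.mul_rpow (by positivity) (by positivity)]
  calc _ = ∫ z : (Fin n → ℝ) × ℝ, (4 * Real.pi) ^ (-(n : ℝ) / 2) /
        ((2:ℝ) ^ a * Real.Gamma ((a + 1) / 2)) * |t| ^ (-((n : ℝ) + a + 1) / 2) *
        ((∏ i, Real.exp (-(4 * |t|)⁻¹ * z.1 i ^ 2)) *
          (z.2 ^ b * Real.exp (-(4 * |t|)⁻¹ * z.2 ^ (2 : ℝ))))
        ∂(volume.prod (volume.restrict (Set.Ioi 0))) := by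
        congr 1 with z
        rw [Gbar_eq_mul_prod]
        ring
    _ = _ := by
        rw [integral_const_mul, integral_prod_mul
          (fun x : Fin n → ℝ => ∏ i, Real.exp (-(4 * |t|)⁻¹ * x i ^ 2))
          (fun y : ℝ => y ^ b * Real.exp (-(4 * |t|)⁻¹ * y ^ (2 : ℝ))),
          integral_rpow_mul_exp_neg_mul_rpow two_pos hb hc,
          integral_fintype_prod_volume_eq_pow (fun s : ℝ => Real.exp (-(4 * |t|)⁻¹ * s ^ 2)),
          integral_gaussian, Fintype.card_fin, hsqrt, hinv,
          show (b - a) / 2 = -((n : ℝ) + a + 1) / 2 + 1 / 2 * n + (b + 1) / 2 by ring,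
          Real.rpow_add ht', Real.rpow_add ht']
        ring

theorem integrableOn_Gbar_mul_rpow {a b : ℝ} (ha : -1 < a) (hb : -1 < b) (hab : a < b + 2) :
    IntegrableOn (fun p : Pt n => Gbar n a p.1 p.2.1 p.2.2 * p.2.1 ^ b) (openStrip n r) := by
  rw [integrableOn_openStrip_iff, integrable_prod_iff']
  · refine ⟨(ae_restrict_iff' measurableSet_Ioo).2 (.of_forall fun t ht =>
      integrable_Gbar_mul_rpow_slice a hb ht.2), ?_⟩
    obtain ⟨K, hK⟩ := exists_integral_Gbar_mul_rpow_slice n a hb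
    refine IntegrableOn.congr_fun ((integrableOn_abs_rpow (r := r) (e := (b - a) / 2)
      (by linarith)).const_mul K) (fun t ht => ?_) measurableSet_Ioo
    rw [← hK t ht.2, ← Measure.restrict_univ (μ := (volume : Measure (Fin n → ℝ))),
      Measure.prod_restrict]
    refine setIntegral_congr_fun (MeasurableSet.univ.prod measurableSet_Ioi) fun z hz => ?_
    have : 0 < z.2 := hz.2
    exact (Real.norm_of_nonneg (mul_nonneg (Gbar_nonneg ha _ _ _) (by positivity))).symm
  · apply Measurable.aestronglyMeasurable
    unfold Gbar nsq
    fun_prop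

end Measure

section Divergence

variable {n : ℕ} {r R t : ℝ}

theorem prod_restrict_Ioi (n : ℕ) (ε : ℝ) :
    (volume : Measure (Fin n → ℝ)).prod ((volume : Measure ℝ).restrict (Set.Ioi ε))
      = volume.restrict (Set.univ ×ˢ Set.Ioi ε) := by
  rw [Measure.volume_eq_prod, ← Measure.prod_restrict, Measure.restrict_univ]

theorem sq_lt_nsq_of_notMem_Icc (hR : 0 < R) {x : Fin n → ℝ} (y : ℝ)
    (hx : x ∉ Set.Icc (fun _ => -R) fun _ => R) : R ^ 2 < nsq x y := by
  have h : ∃ i, R ^ 2 < x i ^ 2 := by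
    by_contra! h
    exact hx ⟨fun i => (abs_le.1 (abs_le_of_sq_le_sq (h i) hR.le)).1,
      fun i => (abs_le.1 (abs_le_of_sq_le_sq (h i) hR.le)).2⟩
  obtain ⟨i, hi⟩ := h
  have := Finset.single_le_sum (f := fun i => x i ^ 2) (fun j _ => sq_nonneg (x j))
    (Finset.mem_univ i)
  unfold nsq
  nlinarith [sq_nonneg y]

theorem sq_le_nsq (x : Fin n → ℝ) (y : ℝ) : y ^ 2 ≤ nsq x y := by
  have := Finset.sum_nonneg fun i (_ : i ∈ Finset.univ) => sq_nonneg (x i)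
  unfold nsq
  linarith

theorem continuous_nsq : Continuous fun z : (Fin n → ℝ) × ℝ => nsq z.1 z.2 := by
  unfold nsq
  fun_prop

theorem pdx_eq_zero_of_sq_lt {V : Fn n} (i : Fin n) (hV : ∀ x y, R ^ 2 ≤ nsq x y → V x y t = 0)
    {x : Fin n → ℝ} {y : ℝ} (h : R ^ 2 < nsq x y) : pdx i V x y t = 0 := by
  have hev : (fun x' => V x' y t) =ᶠ[𝓝 x] fun _ => 0 := by
    filter_upwards [(isOpen_lt continuous_const (continuous_nsq.comp
      (Continuous.prodMk_left y))).mem_nhds h] with x' hx' using hV x' y (le_of_lt hx')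
  simp [pdx, hev.fderiv_eq]

theorem pdy_eq_zero_of_sq_lt {V : Fn n} (hV : ∀ x y, R ^ 2 ≤ nsq x y → V x y t = 0)
    {x : Fin n → ℝ} {y : ℝ} (h : R ^ 2 < nsq x y) : pdy V x y t = 0 := by
  have hev : (fun y' => V x y' t) =ᶠ[𝓝 y] fun _ => 0 := by
    filter_upwards [(isOpen_lt continuous_const (continuous_nsq.comp
      (Continuous.prodMk_right x))).mem_nhds h] with y' hy' using hV x y' (le_of_lt hy')
  simp [pdy, hev.deriv_eq]

theorem ContinuousOn.unc_slice {V : Fn n} (hV : ContinuousOn (unc V) (openStrip n r))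
    (ht : t ∈ Set.Ioo (-(r ^ 2)) 0) :
    ContinuousOn (fun z : (Fin n → ℝ) × ℝ => V z.1 z.2 t) {z | 0 < z.2} :=
  hV.comp (f := fun z : (Fin n → ℝ) × ℝ => ((z.1, z.2, t) : Pt n)) (by fun_prop)
    fun _ hz => ⟨hz, ht⟩

theorem integrable_prod_Ioi_of_continuousOn (hR : 0 < R) {f : (Fin n → ℝ) × ℝ → ℝ}
    (hf : ContinuousOn f {z | 0 < z.2}) (hf0 : ∀ z, R ^ 2 < nsq z.1 z.2 → f z = 0)
    {ε : ℝ} (hε : 0 < ε) : Integrable f (volume.prod (volume.restrict (Set.Ioi ε))) := by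
  rw [prod_restrict_Ioi]
  have hK : IsCompact ((Set.Icc (fun _ => -R) fun _ => R : Set (Fin n → ℝ)) ×ˢ Set.Icc ε R) :=
    isCompact_Icc.prod isCompact_Icc
  have hfK := (hf.mono fun z hz => hε.trans_le hz.2.1).integrableOn_compact (μ := volume) hK
  refine IntegrableOn.of_forall_sdiff_eq_zero hfK
    (MeasurableSet.univ.prod measurableSet_Ioi) fun z hz => hf0 z ?_
  obtain ⟨⟨-, hz2⟩, hz3⟩ := hz
  by_cases hx : z.1 ∈ Set.Icc (fun _ => -R) fun _ => R
  · have : R < z.2 := by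
      by_contra! h
      exact hz3 ⟨hx, le_of_lt hz2, h⟩
    exact (pow_lt_pow_left₀ this hR.le two_ne_zero).trans_le (sq_le_nsq _ _)
  · exact sq_lt_nsq_of_notMem_Icc hR _ hx

theorem integral_pdx_eq_zero (hR : 0 < R) {V : Fn n} (i : Fin n)
    (hV : ContDiffOn ℝ ∞ (unc V) (openStrip n r)) (ht : t ∈ Set.Ioo (-(r ^ 2)) 0)
    (hV0 : ∀ x y, R ^ 2 ≤ nsq x y → V x y t = 0) {y : ℝ} (hy : 0 < y) :
    ∫ x, pdx i V x y t = 0 := by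
  have hc : Continuous fun x => V x y t :=
    (hV.continuousOn.unc_slice ht).comp_continuous (Continuous.prodMk_left y) fun _ => hy
  have hc' : Continuous fun x => pdx i V x y t :=
    ((hV.pdx i).continuousOn.unc_slice ht).comp_continuous (Continuous.prodMk_left y) fun _ => hy
  have hK : IsCompact (Set.Icc (fun _ => -R) fun _ => R : Set (Fin n → ℝ)) := isCompact_Icc
  have hi := hc.integrable_of_hasCompactSupport (μ := volume) (HasCompactSupport.intro hK
    fun x hx => hV0 x y (sq_lt_nsq_of_notMem_Icc hR y hx).le)
  have hi' := hc'.integrable_of_hasCompactSupport (μ := volume) (HasCompactSupport.intro hK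
    fun x hx => pdx_eq_zero_of_sq_lt i hV0 (sq_lt_nsq_of_notMem_Icc hR y hx))
  have := integral_mul_fderiv_eq_neg_fderiv_mul_of_integrable (μ := volume) (𝕜 := ℝ)
    (f := fun _ : Fin n → ℝ => (1 : ℝ)) (g := fun x => V x y t) (v := Pi.single i 1)
    (by simp) (by simpa [pdx] using hi') (by simpa using hi) (fun x _ => by fun_prop)
    (fun x _ => (hV.unc_differentiableAt (p := (x, y, t))
      ⟨hy, ht⟩).unc_hasFDerivAt_x.differentiableAt)
  simpa [pdx] using this

theorem integral_Ioi_pdy (hR : 0 < R) {W : Fn n}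
    (hW : ContDiffOn ℝ ∞ (unc W) (openStrip n r)) (ht : t ∈ Set.Ioo (-(r ^ 2)) 0)
    (hW0 : ∀ x y, R ^ 2 ≤ nsq x y → W x y t = 0) {ε : ℝ} (hε : 0 < ε) (x : Fin n → ℝ)
    (hint : IntegrableOn (fun y => pdy W x y t) (Set.Ioi ε)) :
    ∫ y in Set.Ioi ε, pdy W x y t = -W x ε t := by
  rw [integral_Ioi_of_hasDerivAt_of_tendsto' (f := fun y => W x y t) (m := 0) (fun y hy => ?_)
    hint, zero_sub]
  · refine tendsto_const_nhds.congr' ?_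
    filter_upwards [eventually_ge_atTop R] with y hy
    exact (hW0 x y ((pow_le_pow_left₀ hR.le hy 2).trans (sq_le_nsq x y))).symm
  · exact (hW.unc_differentiableAt (p := (x, y, t))
      ⟨hε.trans_le hy, ht⟩).unc_hasDerivAt_y.differentiableAt.hasDerivAt

/-- The divergence theorem in the half-space `{y > ε}` for a field of bounded support. -/
theorem integral_divergence_Ioi (hR : 0 < R) {A : Fin n → Fn n} {W : Fn n}
    (hA : ∀ i, ContDiffOn ℝ ∞ (unc (A i)) (openStrip n r))
    (hW : ContDiffOn ℝ ∞ (unc W) (openStrip n r)) (ht : t ∈ Set.Ioo (-(r ^ 2)) 0)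
    (hA0 : ∀ i x y, R ^ 2 ≤ nsq x y → A i x y t = 0)
    (hW0 : ∀ x y, R ^ 2 ≤ nsq x y → W x y t = 0) {ε : ℝ} (hε : 0 < ε) :
    ∫ z, (∑ i, pdx i (A i) z.1 z.2 t) + pdy W z.1 z.2 t
      ∂((volume : Measure (Fin n → ℝ)).prod (volume.restrict (Set.Ioi ε)))
      = -∫ x, W x ε t := by
  have hiA : ∀ i, Integrable (fun z : (Fin n → ℝ) × ℝ => pdx i (A i) z.1 z.2 t)
      (volume.prod (volume.restrict (Set.Ioi ε))) := fun i =>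
    integrable_prod_Ioi_of_continuousOn hR (((hA i).pdx i).continuousOn.unc_slice ht)
      (fun z hz => pdx_eq_zero_of_sq_lt i (hA0 i) hz) hε
  have hiW : Integrable (fun z : (Fin n → ℝ) × ℝ => pdy W z.1 z.2 t)
      (volume.prod (volume.restrict (Set.Ioi ε))) :=
    integrable_prod_Ioi_of_continuousOn hR (hW.pdy.continuousOn.unc_slice ht)
      (fun z hz => pdy_eq_zero_of_sq_lt hW0 hz) hε
  rw [integral_add (integrable_finsetSum _ fun i _ => hiA i) hiW,
    integral_finsetSum _ fun i _ => hiA i, Finset.sum_eq_zero fun i _ => ?_, zero_add,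
    integral_prod _ hiW, ← integral_neg]
  · refine integral_congr_ae ?_
    filter_upwards [hiW.prod_right_ae] with x hx
    exact integral_Ioi_pdy hR hW ht hW0 hε x hx
  · rw [integral_prod_symm _ (hiA i)]
    exact setIntegral_eq_zero_of_forall_eq_zero fun y hy =>
      integral_pdx_eq_zero hR i (hA i) ht (hA0 i) (hε.trans hy)

/-- The divergence theorem in `{y > 0}` for a field of bounded support whose normal component
is bounded and vanishes on the thin space. -/
theorem integral_divergence_eq_zero (hR : 0 < R) {A : Fin n → Fn n} {W : Fn n}
    (hA : ∀ i, ContDiffOn ℝ ∞ (unc (A i)) (openStrip n r))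
    (hW : ContDiffOn ℝ ∞ (unc W) (openStrip n r)) (ht : t ∈ Set.Ioo (-(r ^ 2)) 0)
    (hA0 : ∀ i x y, R ^ 2 ≤ nsq x y → A i x y t = 0)
    (hW0 : ∀ x y, R ^ 2 ≤ nsq x y → W x y t = 0) {C : ℝ}
    (hWC : ∀ x y, 0 < y → |W x y t| ≤ C)
    (hlim : ∀ x, Tendsto (fun y => W x y t) (𝓝[>] 0) (𝓝 0))
    (hint : Integrable (fun z : (Fin n → ℝ) × ℝ =>
      (∑ i, pdx i (A i) z.1 z.2 t) + pdy W z.1 z.2 t)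
      (volume.prod (volume.restrict (Set.Ioi 0)))) :
    ∫ z, (∑ i, pdx i (A i) z.1 z.2 t) + pdy W z.1 z.2 t
      ∂((volume : Measure (Fin n → ℝ)).prod (volume.restrict (Set.Ioi 0))) = 0 := by
  have hε : ∀ k : ℕ, (0 : ℝ) < 1 / (k + 1) := fun k => Nat.one_div_pos_of_nat
  have hU : ⋃ k : ℕ, (Set.univ : Set (Fin n → ℝ)) ×ˢ Set.Ioi (1 / ((k : ℝ) + 1))
      = Set.univ ×ˢ Set.Ioi 0 := by
    ext z
    simp only [Set.mem_iUnion, Set.mem_prod, Set.mem_univ, true_and, Set.mem_Ioi]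
    exact ⟨fun ⟨k, hk⟩ => (hε k).trans hk, exists_nat_one_div_lt⟩
  have h1 := tendsto_setIntegral_of_monotone (μ := (volume : Measure ((Fin n → ℝ) × ℝ)))
    (f := fun z => (∑ i, pdx i (A i) z.1 z.2 t) + pdy W z.1 z.2 t)
    (s := fun k : ℕ => (Set.univ : Set (Fin n → ℝ)) ×ˢ Set.Ioi (1 / ((k : ℝ) + 1)))
    (fun k => MeasurableSet.univ.prod measurableSet_Ioi)
    (fun k l hkl => Set.prod_mono le_rfl (Set.Ioi_subset_Ioi (Nat.one_div_le_one_div hkl)))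
    (by rw [hU]; rwa [prod_restrict_Ioi] at hint)
  simp only [hU, ← prod_restrict_Ioi] at h1
  simp only [integral_divergence_Ioi hR hA hW ht hA0 hW0 (hε _)] at h1
  refine tendsto_nhds_unique h1 ?_
  have hK : IsCompact (Set.Icc (fun _ => -R) fun _ => R : Set (Fin n → ℝ)) := isCompact_Icc
  have h2 : Tendsto (fun k : ℕ => ∫ x, W x (1 / ((k : ℝ) + 1)) t) atTop
      (𝓝 (∫ _ : Fin n → ℝ, (0 : ℝ))) := by
    refine tendsto_integral_of_dominated_convergence
      ((Set.Icc (fun _ => -R) fun _ => R : Set (Fin n → ℝ)).indicator fun _ => C) (fun k => ?_)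
      ((integrable_indicator_iff hK.measurableSet).2
        (integrableOn_const hK.measure_lt_top.ne)) (fun k => .of_forall fun x => ?_)
      (.of_forall fun x => (hlim x).comp ?_)
    · exact ((hW.continuousOn.unc_slice ht).comp_continuous (Continuous.prodMk_left _)
        fun _ => hε k).aestronglyMeasurable
    · by_cases hx : x ∈ Set.Icc (fun _ => -R) fun _ => R
      · simpa [hx] using hWC x _ (hε k)
      · rw [hW0 x _ (sq_lt_nsq_of_notMem_Icc hR _ hx).le]
        simp [hx]
    · exact tendsto_nhdsWithin_iff.2
        ⟨tendsto_one_div_add_atTop_nhds_zero_nat, .of_forall fun k => hε k⟩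
  simpa using h2.neg

end Divergence

section Signorini

variable {n : ℕ} {a r : ℝ} {F U : Fn n}

theorem mem_Ioc_of_mem_Ioo_sq (hr : r ∈ Set.Ioo (0 : ℝ) 1) {t : ℝ}
    (ht : t ∈ Set.Ioo (-(r ^ 2)) 0) : t ∈ Set.Ioc (-1 : ℝ) 0 :=
  ⟨by nlinarith [ht.1, hr.1, hr.2], ht.2.le⟩

theorem SignoriniMem.contDiffOn (hU : SignoriniMem n a F U) (hr : r ∈ Set.Ioo (0 : ℝ) 1) :
    ContDiffOn ℝ ∞ (unc U) (openStrip n r) := fun p hp =>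
  (hU.smooth p.1 p.2.1 p.2.2 hp.1 (mem_Ioc_of_mem_Ioo_sq hr hp.2)).contDiffWithinAt

theorem SignoriniMem.exists_bound (hU : SignoriniMem n a F U) (hr : r ∈ Set.Ioo (0 : ℝ) 1) :
    ∃ M, ∀ x y t, 0 < y → t ∈ Set.Ioo (-(r ^ 2)) 0 → |U x y t| ≤ M := by
  obtain ⟨R, hR, hU0⟩ := hU.bddSupp
  have hK : IsCompact ((Set.Icc (fun _ => -R) fun _ => R : Set (Fin n → ℝ)) ×ˢ
      (Set.Icc 0 R ×ˢ Set.Icc (-(r ^ 2)) 0)) := isCompact_Icc.prod (isCompact_Icc.prod isCompact_Icc)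
  obtain ⟨M, hM⟩ := hK.exists_bound_of_continuousOn (hU.cont.mono fun p hp =>
    ⟨hp.2.1.1, by nlinarith [hp.2.2.1, hr.1, hr.2], hp.2.2.2⟩)
  refine ⟨max M 0, fun x y t hy ht => ?_⟩
  by_cases h : R ^ 2 ≤ nsq x y
  · simp [hU0 x y t h]
  · refine (hM (x, y, t) ⟨?_, ⟨hy.le, ?_⟩, ht.1.le, ht.2.le⟩).trans (le_max_left _ _)
    · by_contra hx
      exact h (sq_lt_nsq_of_notMem_Icc hR y hx).le
    · by_contra! hRy
      exact h ((pow_le_pow_left₀ hR.le hRy.le 2).trans (sq_le_nsq x y))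

theorem abs_le_of_holder_of_eq_zero {f : Fn n} {α C R : ℝ} (hα : 0 < α) (hR : 0 < R)
    (hf : ∀ x y t x' y' t', 0 < y → 0 < y' → t ∈ Set.Ioc (-1 : ℝ) 0 → t' ∈ Set.Ioc (-1 : ℝ) 0 →
      |f x y t - f x' y' t'| ≤
        C * ((∑ j, (x j - x' j) ^ 2) + (y - y') ^ 2 + |t - t'|) ^ (α / 2))
    (hf0 : ∀ x y t, R < y → f x y t = 0) {x : Fin n → ℝ} {y t : ℝ} (hy : 0 < y)
    (ht : t ∈ Set.Ioc (-1 : ℝ) 0) : |f x y t| ≤ |C| * ((R + 1) ^ 2) ^ (α / 2) := by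
  rcases lt_or_ge R y with h | h
  · rw [hf0 x y t h, abs_zero]
    positivity
  · have := hf x y t x (R + 1) t hy (by linarith) ht ht
    rw [hf0 x (R + 1) t (by linarith), sub_zero] at this
    simp only [sub_self, ne_eq, OfNat.ofNat_ne_zero, not_false_eq_true, zero_pow,
      Finset.sum_const_zero, zero_add, abs_zero, add_zero] at this
    refine this.trans (mul_le_mul (le_abs_self C) (Real.rpow_le_rpow (sq_nonneg _) ?_
      (by positivity)) (by positivity) (abs_nonneg C))
    nlinarith

theorem SignoriniMem.exists_bound_pdx (hU : SignoriniMem n a F U) :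
    ∃ M, ∀ i x y t, 0 < y → t ∈ Set.Ioc (-1 : ℝ) 0 → |pdx i U x y t| ≤ M := by
  obtain ⟨R, hR, hU0⟩ := hU.bddSupp
  obtain ⟨α, hα, C, hC⟩ := hU.holderX
  refine ⟨_, fun i x y t hy ht => abs_le_of_holder_of_eq_zero hα hR (hC i) ?_ hy ht⟩
  intro x y t hRy
  exact pdx_eq_zero_of_sq_lt i (fun x y => hU0 x y t)
    ((pow_lt_pow_left₀ hRy hR.le two_ne_zero).trans_le (sq_le_nsq x y))

theorem SignoriniMem.exists_bound_pdy (hU : SignoriniMem n a F U) :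
    ∃ M, ∀ x y t, 0 < y → t ∈ Set.Ioc (-1 : ℝ) 0 → |y ^ a * pdy U x y t| ≤ M := by
  obtain ⟨R, hR, hU0⟩ := hU.bddSupp
  obtain ⟨α, hα, C, hC⟩ := hU.holderY
  refine ⟨_, fun x y t hy ht => abs_le_of_holder_of_eq_zero
    (f := fun x y t => y ^ a * pdy U x y t) hα hR hC ?_ hy ht⟩
  intro x y t hRy
  simp only [pdy_eq_zero_of_sq_lt (fun x y => hU0 x y t)
    ((pow_lt_pow_left₀ hRy hR.le two_ne_zero).trans_le (sq_le_nsq x y)), mul_zero]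

theorem SignoriniMem.continuousOn_source (hU : SignoriniMem n a F U)
    (hr : r ∈ Set.Ioo (0 : ℝ) 1) : ContinuousOn (unc F) (openStrip n r) := by
  have h := hU.contDiffOn hr
  have hlap : ContinuousOn (fun p => ∑ i, unc (pdx i (pdx i U)) p) (openStrip n r) :=
    continuousOn_finsetSum _ fun i _ => ((h.pdx i).pdx i).continuousOn
  have hdrift : ContinuousOn (fun p : Pt n => a / p.2.1 * unc (pdy U) p) (openStrip n r) :=
    (continuousOn_const.div (by fun_prop) fun p hp => hp.1.ne').mul h.pdy.continuousOn
  refine (((h.pdt.continuousOn.sub hlap).sub h.pdy.pdy.continuousOn).sub hdrift).congr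
    fun p hp => ?_
  have := hU.pde p.1 p.2.1 p.2.2 hp.1 (mem_Ioc_of_mem_Ioo_sq hr hp.2)
  simp only [lapFull, lapx, pdyy] at this
  simp only [unc, Pi.sub_apply]
  linarith

theorem wgt_nonneg (ha : -1 < a) {p : Pt n} (hy : 0 < p.2.1) : 0 ≤ wgt n a p :=
  mul_nonneg (Gbar_nonneg ha _ _ _) (Real.rpow_nonneg hy.le a)

theorem integrableOn_mul_wgt (ha₁ : -1 < a) {f : Pt n → ℝ} {C : ℝ}
    (hf : ContinuousOn f (openStrip n r)) (hC : ∀ p ∈ openStrip n r, |f p| ≤ C) :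
    IntegrableOn (fun p => f p * wgt n a p) (openStrip n r) := by
  have hS := (isOpen_openStrip n r).measurableSet
  refine Integrable.mono' ((integrableOn_Gbar_mul_rpow (n := n) (r := r) ha₁ ha₁
    (by linarith)).const_mul C) ((hf.mul (contDiffOn_wgt a).continuousOn).aestronglyMeasurable hS)
    ((ae_restrict_iff' hS).2 (.of_forall fun p hp => ?_))
  rw [norm_mul, Real.norm_eq_abs, Real.norm_of_nonneg (wgt_nonneg ha₁ hp.1)]
  exact mul_le_mul_of_nonneg_right (hC p hp) (wgt_nonneg ha₁ hp.1)

theorem SignoriniMem.integrableOn_source (hU : SignoriniMem n a F U) (ha₁ : -1 < a)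
    (hF : ∃ M : ℝ, ∀ x y t, 0 < y → t ∈ Set.Ioc (-1 : ℝ) 0 → |F x y t| ≤ M)
    (hr : r ∈ Set.Ioo (0 : ℝ) 1) :
    IntegrableOn (fun p : Pt n => |p.2.2| * U p.1 p.2.1 p.2.2 * F p.1 p.2.1 p.2.2 * wgt n a p)
      (openStrip n r) := by
  obtain ⟨M, hM⟩ := hU.exists_bound hr
  obtain ⟨N, hN⟩ := hF
  refine integrableOn_mul_wgt (C := 1 * M * N) ha₁ ?_ fun p hp => ?_
  · exact ((by fun_prop : Continuous fun p : Pt n => |p.2.2|).continuousOn.mul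
      (hU.contDiffOn hr).continuousOn).mul (hU.continuousOn_source hr)
  · have ht := mem_Ioc_of_mem_Ioo_sq hr hp.2
    have h1 := hM p.1 _ _ hp.1 hp.2
    have h2 := hN p.1 _ _ hp.1 ht
    have h0 := (abs_nonneg _).trans h1
    rw [abs_mul, abs_mul, abs_abs]
    gcongr
    exact abs_le.2 ⟨ht.1.le, ht.2.trans zero_le_one⟩

theorem SignoriniMem.continuousOn_Zop (hU : SignoriniMem n a F U) (hr : r ∈ Set.Ioo (0 : ℝ) 1) :
    ContinuousOn (unc (Zop U)) (openStrip n r) := by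
  have h := hU.contDiffOn hr
  refine ((continuousOn_finsetSum _ fun i _ => ?_).add ?_).add ?_
  · exact (by fun_prop : Continuous fun p : Pt n => p.1 i).continuousOn.mul (h.pdx i).continuousOn
  · exact (by fun_prop : Continuous fun p : Pt n => p.2.1).continuousOn.mul h.pdy.continuousOn
  · exact (by fun_prop : Continuous fun p : Pt n => 2 * p.2.2).continuousOn.mul h.pdt.continuousOn

theorem SignoriniMem.exists_bound_mul_Zop (hU : SignoriniMem n a F U) (ha₂ : a < 1)
    (hr : r ∈ Set.Ioo (0 : ℝ) 1) :
    ∃ M, ∀ x y t, 0 < y → t ∈ Set.Ioo (-(r ^ 2)) 0 → |U x y t * Zop U x y t| ≤ M := by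
  obtain ⟨R, hR, hU0⟩ := hU.bddSupp
  obtain ⟨M, hM⟩ := hU.exists_bound hr
  obtain ⟨Mx, hMx⟩ := hU.exists_bound_pdx
  obtain ⟨My, hMy⟩ := hU.exists_bound_pdy
  obtain ⟨Mt, hMt⟩ := hU.bddTime
  refine ⟨max (M * (n * (R * Mx) + R ^ (1 - a) * My + 2 * Mt)) 0, fun x y t hy ht => ?_⟩
  by_cases h : R ^ 2 ≤ nsq x y
  · simp [hU0 x y t h]
  refine le_max_of_le_left ?_
  have ht' := mem_Ioc_of_mem_Ioo_sq hr ht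
  have hyR : y ≤ R := by
    by_contra! hRy
    exact h ((pow_le_pow_left₀ hR.le hRy.le 2).trans (sq_le_nsq x y))
  have hx : x ∈ Set.Icc (fun _ => -R) fun _ => R := by
    by_contra hx
    exact h (sq_lt_nsq_of_notMem_Icc hR y hx).le
  have hX : |∑ i, x i * pdx i U x y t| ≤ n * (R * Mx) := by
    refine (Finset.abs_sum_le_sum_abs _ _).trans ((Finset.sum_le_card_nsmul _ _ (R * Mx)
      fun i _ => ?_).trans_eq (by simp))
    rw [abs_mul]
    exact mul_le_mul (abs_le.2 ⟨hx.1 i, hx.2 i⟩) (hMx i x y t hy ht') (abs_nonneg _) hR.le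
  have hY : |y * pdy U x y t| ≤ R ^ (1 - a) * My := by
    have : y * pdy U x y t = y ^ (1 - a) * (y ^ a * pdy U x y t) := by
      rw [← mul_assoc, ← Real.rpow_add hy, sub_add_cancel, Real.rpow_one]
    rw [this, abs_mul, abs_of_nonneg (Real.rpow_nonneg hy.le _)]
    exact mul_le_mul (Real.rpow_le_rpow hy.le hyR (by linarith)) (hMy x y t hy ht')
      (abs_nonneg _) (Real.rpow_nonneg hR.le _)
  have hT : |2 * t * pdt U x y t| ≤ 2 * Mt := by
    rw [abs_mul]
    exact mul_le_mul (abs_le.2 ⟨by linarith [ht'.1], by linarith [ht'.2]⟩) (hMt x y t hy ht')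
      (abs_nonneg _) zero_le_two
  rw [abs_mul]
  have h0 := hM x y t hy ht
  refine mul_le_mul h0 ?_ (abs_nonneg _) ((abs_nonneg _).trans h0)
  exact (abs_add_three _ _ _).trans (add_le_add (add_le_add hX hY) hT)

theorem SignoriniMem.integrableOn_mul_Zop (hU : SignoriniMem n a F U) (ha₁ : -1 < a)
    (ha₂ : a < 1) (hr : r ∈ Set.Ioo (0 : ℝ) 1) :
    IntegrableOn (fun p : Pt n => U p.1 p.2.1 p.2.2 * Zop U p.1 p.2.1 p.2.2 * wgt n a p)
      (openStrip n r) := by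
  obtain ⟨M, hM⟩ := hU.exists_bound_mul_Zop ha₂ hr
  exact integrableOn_mul_wgt ha₁ ((hU.contDiffOn hr).continuousOn.mul (hU.continuousOn_Zop hr))
    fun p hp => hM p.1 _ _ hp.1 hp.2

theorem SignoriniMem.integrableOn_gradSq (hU : SignoriniMem n a F U) (ha₁ : -1 < a)
    (ha₂ : a < 1) (hr : r ∈ Set.Ioo (0 : ℝ) 1) :
    IntegrableOn (fun p : Pt n => |p.2.2| * gradSq U p.1 p.2.1 p.2.2 * wgt n a p)
      (openStrip n r) := by
  obtain ⟨Mx, hMx⟩ := hU.exists_bound_pdx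
  obtain ⟨My, hMy⟩ := hU.exists_bound_pdy
  have h := hU.contDiffOn hr
  have hS := (isOpen_openStrip n r).measurableSet
  have hc : ContinuousOn (unc (gradSq U)) (openStrip n r) :=
    (continuousOn_finsetSum _ fun i _ => (h.pdx i).continuousOn.pow 2).add
      (h.pdy.continuousOn.pow 2)
  refine Integrable.mono' (((integrableOn_Gbar_mul_rpow (n := n) (r := r) ha₁ ha₁
    (by linarith)).const_mul (n * Mx ^ 2)).add ((integrableOn_Gbar_mul_rpow (n := n) (r := r)
    (b := -a) ha₁ (by linarith) (by linarith)).const_mul (My ^ 2)))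
    ((((by fun_prop : Continuous fun p : Pt n => |p.2.2|).continuousOn.mul hc).mul
      (contDiffOn_wgt a).continuousOn).aestronglyMeasurable hS)
    ((ae_restrict_iff' hS).2 (.of_forall fun ⟨x, y, t⟩ hp => ?_))
  have hy : 0 < y := hp.1
  have ht := mem_Ioc_of_mem_Ioo_sq hr hp.2
  have hG := Gbar_nonneg ha₁ x y t
  have hya := Real.rpow_pos_of_pos hy a
  have hX : ∑ i, pdx i U x y t ^ 2 ≤ n * Mx ^ 2 :=
    (Finset.sum_le_card_nsmul _ _ (Mx ^ 2) fun i _ => sq_le_sq' (abs_le.1 (hMx i x y t hy ht)).1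
      (abs_le.1 (hMx i x y t hy ht)).2).trans_eq (by simp)
  have hY : (y ^ a * pdy U x y t) ^ 2 ≤ My ^ 2 :=
    sq_le_sq' (abs_le.1 (hMy x y t hy ht)).1 (abs_le.1 (hMy x y t hy ht)).2
  have hY' : pdy U x y t ^ 2 * y ^ a = (y ^ a * pdy U x y t) ^ 2 * y ^ (-a) := by
    rw [Real.rpow_neg hy.le]
    field_simp
  have hg : 0 ≤ gradSq U x y t := by
    unfold gradSq
    positivity
  have habs : |t| ≤ 1 := abs_le.2 ⟨ht.1.le, ht.2.trans zero_le_one⟩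
  have hw : 0 ≤ wgt n a (x, y, t) := wgt_nonneg ha₁ hy
  simp only [Pi.add_apply]
  rw [Real.norm_of_nonneg (by positivity)]
  calc |t| * gradSq U x y t * wgt n a (x, y, t)
      ≤ 1 * gradSq U x y t * wgt n a (x, y, t) := by gcongr
    _ = (∑ i, pdx i U x y t ^ 2) * (Gbar n a x y t * y ^ a)
        + (y ^ a * pdy U x y t) ^ 2 * (Gbar n a x y t * y ^ (-a)) := by
      simp only [gradSq, wgt]
      linear_combination Gbar n a x y t * hY'
    _ ≤ _ := by gcongr

/-- The energy balance as the divergence of the field `U Ḡ_a yᵃ ∇U`. -/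
theorem SignoriniMem.divergence_eq (hU : SignoriniMem n a F U) (hr : r ∈ Set.Ioo (0 : ℝ) 1)
    {x : Fin n → ℝ} {y t : ℝ} (hy : 0 < y) (ht : t ∈ Set.Ioo (-(r ^ 2)) 0) :
    |t| * gradSq U x y t * wgt n a (x, y, t) - |t| * U x y t * F x y t * wgt n a (x, y, t)
        - 1 / 2 * (U x y t * Zop U x y t * wgt n a (x, y, t))
      = |t| * ((∑ i, pdx i (fun x y t => U x y t * (wgt n a (x, y, t) * pdx i U x y t)) x y t)
        + pdy (fun x y t => U x y t * (wgt n a (x, y, t) * pdy U x y t)) x y t) := by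
  have h := hU.contDiffOn hr
  have hp : (x, y, t) ∈ openStrip n r := ⟨hy, ht⟩
  have hw := contDiffOn_wgt (n := n) (r := r) a
  have hX : ∀ i, pdx i (fun x y t => U x y t * (wgt n a (x, y, t) * pdx i U x y t)) x y t
      = pdx i U x y t ^ 2 * wgt n a (x, y, t)
        + x i * pdx i U x y t * (U x y t * wgt n a (x, y, t) / (2 * t))
        + pdx i (pdx i U) x y t * (U x y t * wgt n a (x, y, t)) := fun i => by
    rw [pdx_mul i (h.unc_differentiableAt hp)
      (ContDiffOn.unc_differentiableAt (V := fun x y t => wgt n a (x, y, t) * pdx i U x y t)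
        (hw.mul (h.pdx i)) hp),
      pdx_mul i (hw.unc_differentiableAt hp) ((h.pdx i).unc_differentiableAt hp),
      pdx_wgt a i ht.2]
    ring
  rw [Finset.sum_congr rfl fun i _ => hX i, pdy_mul (h.unc_differentiableAt hp)
      (ContDiffOn.unc_differentiableAt (V := fun x y t => wgt n a (x, y, t) * pdy U x y t)
        (hw.mul h.pdy) hp),
    pdy_mul (hw.unc_differentiableAt hp) (h.pdy.unc_differentiableAt hp), pdy_wgt a hy ht.2]
  have hpde := hU.pde x y t hy (mem_Ioc_of_mem_Ioo_sq hr ht)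
  simp only [lapFull, lapx, pdyy] at hpde
  simp only [Finset.sum_add_distrib, ← Finset.sum_mul, gradSq, Zop, abs_of_neg ht.2]
  rw [hpde]
  have ht0 : t ≠ 0 := ht.2.ne
  field_simp
  ring

theorem SignoriniMem.integral_slice_eq_zero (hU : SignoriniMem n a F U) (ha₁ : -1 < a)
    (hr : r ∈ Set.Ioo (0 : ℝ) 1) {t : ℝ} (ht : t ∈ Set.Ioo (-(r ^ 2)) 0)
    (hint : Integrable (fun z : (Fin n → ℝ) × ℝ =>
      (∑ i, pdx i (fun x y t => U x y t * (wgt n a (x, y, t) * pdx i U x y t)) z.1 z.2 t)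
        + pdy (fun x y t => U x y t * (wgt n a (x, y, t) * pdy U x y t)) z.1 z.2 t)
      (volume.prod (volume.restrict (Set.Ioi 0)))) :
    ∫ z, (∑ i, pdx i (fun x y t => U x y t * (wgt n a (x, y, t) * pdx i U x y t)) z.1 z.2 t)
        + pdy (fun x y t => U x y t * (wgt n a (x, y, t) * pdy U x y t)) z.1 z.2 t
      ∂((volume : Measure (Fin n → ℝ)).prod (volume.restrict (Set.Ioi 0))) = 0 := by
  obtain ⟨R, hR, hU0⟩ := hU.bddSupp
  obtain ⟨M, hM⟩ := hU.exists_bound hr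
  obtain ⟨My, hMy⟩ := hU.exists_bound_pdy
  have h := hU.contDiffOn hr
  have hw := contDiffOn_wgt (n := n) (r := r) a
  have ht' := mem_Ioc_of_mem_Ioo_sq hr ht
  have hGle : ∀ x y, Gbar n a x y t ≤ Gbar n a 0 0 t := fun x y => by
    have : 0 < Real.Gamma ((a + 1) / 2) := Real.Gamma_pos_of_pos (by linarith)
    have hnsq : 0 ≤ nsq x y := (sq_nonneg y).trans (sq_le_nsq x y)
    unfold Gbar
    refine mul_le_mul_of_nonneg_left (Real.exp_le_exp.2 ?_) (by positivity)
    simp only [nsq, Pi.zero_apply, ne_eq, OfNat.ofNat_ne_zero, not_false_eq_true, zero_pow,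
      Finset.sum_const_zero, add_zero, neg_zero, zero_div]
    exact div_nonpos_of_nonpos_of_nonneg (neg_nonpos.2 hnsq) (by positivity)
  have hG0 := Gbar_nonneg ha₁ (0 : Fin n → ℝ) 0 t
  have heq : ∀ x y, U x y t * (wgt n a (x, y, t) * pdy U x y t)
      = U x y t * (Gbar n a x y t * (y ^ a * pdy U x y t)) := fun x y => by
    rw [wgt]
    ring
  refine integral_divergence_eq_zero (C := M * (Gbar n a 0 0 t * My)) hR
    (fun i => h.mul (hw.mul (h.pdx i))) (h.mul (hw.mul h.pdy)) ht
    (fun i x y hxy => by simp [hU0 x y t hxy]) (fun x y hxy => by simp [hU0 x y t hxy])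
    (fun x y hy => ?_) (fun x => ?_) hint
  · rw [heq, abs_mul, abs_mul, abs_of_nonneg (Gbar_nonneg ha₁ x y t)]
    have h1 := hM x y t hy ht
    exact mul_le_mul h1 (mul_le_mul (hGle x y) (hMy x y t hy ht') (abs_nonneg _) hG0)
      (mul_nonneg (Gbar_nonneg ha₁ x y t) (abs_nonneg _)) ((abs_nonneg _).trans h1)
  · obtain ⟨L, -, hL, hUL⟩ := hU.signorini x t ht'
    have hUlim : Tendsto (fun y => U x y t) (𝓝[>] 0) (𝓝 (U x 0 t)) := by
      have hcw := hU.cont (x, 0, t) ⟨le_rfl, ht'⟩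
      refine hcw.tendsto.comp (f := fun y : ℝ => ((x, y, t) : Pt n))
        (tendsto_nhdsWithin_iff.2 ⟨?_, ?_⟩)
      · exact ((by fun_prop : Continuous fun y : ℝ => ((x, y, t) : Pt n)).tendsto 0).mono_left
          nhdsWithin_le_nhds
      · filter_upwards [self_mem_nhdsWithin] with y hy using ⟨le_of_lt hy, ht'⟩
    have hGlim : Tendsto (fun y => Gbar n a x y t) (𝓝[>] 0) (𝓝 (Gbar n a x 0 t)) := by
      have : Continuous fun y => Gbar n a x y t := by
        unfold Gbar nsq
        fun_prop
      exact (this.tendsto 0).mono_left nhdsWithin_le_nhds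
    have hlim := hUlim.mul (hGlim.mul hL)
    rw [mul_left_comm, hUL, mul_zero] at hlim
    simpa only [heq] using hlim

theorem SignoriniMem.energy_balance (hU : SignoriniMem n a F U) (ha₁ : -1 < a)
    (hr : r ∈ Set.Ioo (0 : ℝ) 1)
    (hE : IntegrableOn (fun p : Pt n => |p.2.2| * gradSq U p.1 p.2.1 p.2.2 * wgt n a p
      - |p.2.2| * U p.1 p.2.1 p.2.2 * F p.1 p.2.1 p.2.2 * wgt n a p
      - 1 / 2 * (U p.1 p.2.1 p.2.2 * Zop U p.1 p.2.1 p.2.2 * wgt n a p)) (openStrip n r)) :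
    ∫ p in openStrip n r, (|p.2.2| * gradSq U p.1 p.2.1 p.2.2 * wgt n a p
      - |p.2.2| * U p.1 p.2.1 p.2.2 * F p.1 p.2.1 p.2.2 * wgt n a p
      - 1 / 2 * (U p.1 p.2.1 p.2.2 * Zop U p.1 p.2.1 p.2.2 * wgt n a p)) = 0 := by
  rw [setIntegral_openStrip hE]
  refine integral_eq_zero_of_ae ?_
  filter_upwards [(integrableOn_openStrip_iff.1 hE).prod_left_ae, ae_restrict_mem measurableSet_Ioo]
    with t hint ht
  have hpos : ∀ᵐ z ∂((volume : Measure (Fin n → ℝ)).prod (volume.restrict (Set.Ioi (0 : ℝ)))),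
      0 < z.2 :=
    Measure.quasiMeasurePreserving_snd.ae (ae_restrict_mem measurableSet_Ioi)
  have hdiv := hpos.mono fun z hz => hU.divergence_eq hr (x := z.1) hz ht
  have hint' := (integrable_congr hdiv).1 hint
  rw [integrable_const_mul_iff (IsUnit.mk0 _ (abs_ne_zero.2 ht.2.ne))] at hint'
  rw [integral_congr_ae hdiv, integral_const_mul, hU.integral_slice_eq_zero ha₁ hr ht hint',
    mul_zero, Pi.zero_apply]

end Signorini

/-- I(U,r) = D(U,r) − r⁻² ∫ |t| U F Ḡ_a yᵃ. -/
theorem total_energy_identity (n : ℕ) (hn : 1 ≤ n) (a : ℝ) (ha₁ : -1 < a) (ha₂ : a < 1)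
    (F U : Fn n) (hU : SignoriniMem n a F U)
    (hF : ∃ M : ℝ, ∀ x y t, 0 < y → t ∈ Set.Ioc (-1 : ℝ) 0 → |F x y t| ≤ M)
    (r : ℝ) (hr : r ∈ Set.Ioo (0 : ℝ) 1) :
    Ifn n a U r = Dfn n a U r
      - (1 / r ^ 2) *
        ∫ p in Splus n r,
          |p.2.2| * U p.1 p.2.1 p.2.2 * F p.1 p.2.1 p.2.2 * wgt n a p := by
  have hI := hU.integrableOn_mul_Zop ha₁ ha₂ hr
  have hD := hU.integrableOn_gradSq ha₁ ha₂ hr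
  have hS := hU.integrableOn_source ha₁ hF hr
  have hI' := hI.const_mul (1 / 2)
  have hzero := (integral_sub (hD.sub hS) hI').symm.trans
    (hU.energy_balance ha₁ hr ((hD.sub hS).sub hI'))
  rw [integral_sub' hD hS, integral_const_mul] at hzero
  unfold Ifn Dfn
  rw [volume_restrict_Splus]
  have hr0 : r ≠ 0 := hr.1.ne'
  field_simp
  linear_combination -2 * hzero
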